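/- Let K be a number field and let ζ_K be its Dedekind zeta function. For σ > 1 and real t, define f(σ,t) = −Re( (ζ_K'/ζ_K)(σ + it) − κ·(ζ_K'/ζ_K)(σ1 + it) ), where σ1 = 1/2 + (1/2)·√(1+4σ²). Let n ≥ 0 be an integer and a_0, …, a_n nonnegative reals such that the trigonometric polynomial P(θ) = Σ_{k=0}^{n} a_k·cos(kθ) satisfies P(θ) ≥ 0 for all real θ. Then for every σ > 1 and every real γ0, one has Σ_{k=0}^{n} a_k · f(σ, k·γ0) ≥ 0. -/

import Mathlib

open Complex NumberField Filter

/-- `Z : ℂ → ℂ` is (a realization of) the Dedekind zeta function of the number field `K`: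
it is analytic away from `s = 1`, it has a pole at `s = 1`, and on the half-plane
`Re s > 1` it is given by the usual Dirichlet series over the nonzero ideals of the
ring of integers of `K`. -/
def IsDedekindZeta (K : Type) [Field K] [NumberField K] (Z : ℂ → ℂ) : Prop :=
  (∀ s : ℂ, s ≠ 1 → AnalyticAt ℂ Z s) ∧
  Tendsto (fun s : ℂ => ‖Z s‖) (nhdsWithin 1 {(1 : ℂ)}ᶜ) atTop ∧
  ∀ s : ℂ, 1 < s.re →
    Z s = ∑' I : {I : Ideal (𝓞 K) // I ≠ 0}, (Ideal.absNorm I.val : ℂ) ^ (-s)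

noncomputable def kappa : ℝ := 1 / Real.sqrt 5

noncomputable def sigma1 (σ : ℝ) : ℝ := 1 / 2 + Real.sqrt (1 + 4 * σ ^ 2) / 2

/-- `f(σ,t) = -Re( (ζ_K'/ζ_K)(σ+it) - κ (ζ_K'/ζ_K)(σ1+it) )`. -/
noncomputable def fdiff (Z : ℂ → ℂ) (σ t : ℝ) : ℝ :=
  -(logDeriv Z ((σ : ℂ) + (t : ℂ) * Complex.I)
      - (kappa : ℂ) * logDeriv Z ((sigma1 σ : ℂ) + (t : ℂ) * Complex.I)).re

section IdealSums

variable (K : Type) [Field K] [NumberField K]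

theorem lseriesSummable_card_absNorm_eq {s : ℂ} (hs : 1 < s.re) :
    LSeriesSummable (fun n ↦ ((Nat.card {I : Ideal (𝓞 K) // Ideal.absNorm I = n} : ℝ) : ℂ)) s := by
  refine LSeriesSummable_of_sum_norm_bigO_and_nonneg (r := 1) ?_ (fun _ ↦ Nat.cast_nonneg _)
    zero_le_one hs
  have h := ((NumberField.Ideal.tendsto_norm_le_div_atTop₀ K).comp
    tendsto_natCast_atTop_atTop).isBigO_one ℝ
  have h' := h.mul (Asymptotics.isBigO_refl (fun n : ℕ ↦ (n : ℝ)) atTop)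
  refine h'.congr' ?_ (by simp)
  filter_upwards [eventually_ne_atTop 0] with n hn
  have hn' : (n : ℝ) ≠ 0 := by exact_mod_cast hn
  simp only [Function.comp_apply, Nat.cast_le]
  rw [div_mul_cancel₀ _ hn', ← Nat.cast_sum]
  congr
  rw [← add_left_inj 1, ← Ideal.card_norm_le_eq_card_norm_le_add_one,
    show Finset.Icc 1 n = Finset.Ioc 0 n from Finset.Icc_succ_left_eq_Ioc _ _,
    show 1 = Nat.card {I : Ideal (𝓞 K) // Ideal.absNorm I = 0} by simp [Ideal.absNorm_eq_zero_iff],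
    Finset.sum_Ioc_add_eq_sum_Icc (n.zero_le),
    ← Finset.card_preimage_eq_sum_card_image_eq
      (fun k _ ↦ Ideal.finite_setOfPred_absNorm_eq k)]
  simp [Set.coe_eq_subtype]

theorem summable_absNorm_rpow_neg {r : ℝ} (hr : 1 < r) :
    Summable fun I : Ideal (𝓞 K) ↦ (Ideal.absNorm I : ℝ) ^ (-r) := by
  rw [← (Equiv.sigmaFiberEquiv (Ideal.absNorm : Ideal (𝓞 K) → ℕ)).summable_iff,
    summable_sigma_of_nonneg fun _ ↦ by simp only [Function.comp_apply]; positivity]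
  have hfin (n : ℕ) : Finite {I : Ideal (𝓞 K) // Ideal.absNorm I = n} :=
    Ideal.finite_setOfPred_absNorm_eq n
  refine ⟨fun n ↦ Summable.of_finite, ?_⟩
  refine (lseriesSummable_card_absNorm_eq K (s := r) (by simpa using hr)).norm.congr fun n ↦ ?_
  have : ∀ I : {I : Ideal (𝓞 K) // Ideal.absNorm I = n},
      ((fun I : Ideal (𝓞 K) ↦ (Ideal.absNorm I : ℝ) ^ (-r)) ∘
        (Equiv.sigmaFiberEquiv (Ideal.absNorm : Ideal (𝓞 K) → ℕ))) ⟨n, I⟩ = (n : ℝ) ^ (-r) := by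
    rintro ⟨I, rfl⟩; rfl
  rw [tsum_congr this, tsum_const, LSeries.norm_term_eq]
  split_ifs with hn
  · subst hn; rw [Nat.cast_zero, Real.zero_rpow (by linarith), smul_zero]
  · simp [Real.rpow_neg, div_eq_mul_inv]

end IdealSums

section EulerProduct

open IsDedekindDomain

variable {R : Type*} [CommRing R] [IsDedekindDomain R] (h : Ideal R →*₀ ℂ)

open Classical in
theorem tsum_ideal_mul_prod_one_sub (hs : Summable h) (T : Finset (HeightOneSpectrum R)) :
    (∑' I, h I) * ∏ P ∈ T, (1 - h P.asIdeal) =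
      ∑' I, if ∀ P ∈ T, ¬ P.asIdeal ∣ I then h I else 0 := by
  induction T using Finset.induction_on with
  | empty => simp
  | insert P T hP ih =>
    set g : Ideal R → ℂ := fun I ↦ if ∀ Q ∈ T, ¬ Q.asIdeal ∣ I then h I else 0 with hg
    have hgs : Summable g := by
      refine Summable.of_norm_bounded hs.norm fun I ↦ ?_
      simp only [hg]; split_ifs <;> simp
    have hmul (J : Ideal R) : g (P.asIdeal * J) = h P.asIdeal * g J := by
      have : (∀ Q ∈ T, ¬ Q.asIdeal ∣ P.asIdeal * J) ↔ ∀ Q ∈ T, ¬ Q.asIdeal ∣ J := by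
        refine forall₂_congr fun Q hQ ↦ ?_
        rw [Q.prime.dvd_mul, not_or, and_iff_right]
        intro hd
        rw [Q.prime.dvd_prime_iff_associated P.prime, associated_iff_eq] at hd
        exact hP (HeightOneSpectrum.ext hd ▸ hQ)
      simp only [hg, this, map_mul, mul_ite, mul_zero]
    have hdiv : ∑' I, (if P.asIdeal ∣ I then g I else 0) = h P.asIdeal * ∑' I, g I := by
      rw [← tsum_mul_left]
      have hinj : Function.Injective (P.asIdeal * ·) := mul_right_injective₀ P.prime.ne_zero
      rw [← hinj.tsum_eq]
      · exact tsum_congr fun J ↦ by simp [hmul]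
      · intro I hI
        by_contra hn
        exact hI (if_neg fun ⟨J, hJ⟩ ↦ hn ⟨J, hJ.symm⟩)
    rw [Finset.prod_insert hP, mul_left_comm, ih, sub_mul, one_mul, ← hdiv,
      ← hgs.tsum_sub]
    · refine tsum_congr fun I ↦ ?_
      simp only [hg, Finset.forall_mem_insert]
      by_cases hI : P.asIdeal ∣ I <;> simp [hI]
    · refine Summable.of_norm_bounded hgs.norm fun I ↦ ?_
      split_ifs <;> simp

theorem tsum_ideal_mul_tprod_one_sub (hs : Summable h) :
    (∑' I, h I) * ∏' P : HeightOneSpectrum R, (1 - h P.asIdeal) = 1 := by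
  classical
  have hinj : Function.Injective (HeightOneSpectrum.asIdeal : HeightOneSpectrum R → Ideal R) :=
    fun _ _ ↦ HeightOneSpectrum.ext
  have hm : Multipliable fun P : HeightOneSpectrum R ↦ (1 - h P.asIdeal) := by
    simpa only [sub_eq_add_neg] using multipliable_one_add_of_summable
      (f := fun P : HeightOneSpectrum R ↦ - h P.asIdeal)
      (by simpa only [norm_neg, Function.comp_def] using hs.norm.comp_injective hinj)
  refine tendsto_nhds_unique (hm.hasProd.const_mul (∑' I, h I)) ?_
  simp only [tsum_ideal_mul_prod_one_sub h hs]
  rw [← tsum_ite_eq (1 : Ideal R) (fun _ ↦ (1 : ℂ))]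
  refine tendsto_tsum_of_dominated_convergence hs.norm (fun I ↦ ?_)
    (.of_forall fun T I ↦ by split_ifs <;> simp)
  refine tendsto_const_nhds.congr' ?_
  rcases eq_or_ne I 0 with rfl | h0
  · exact .of_forall fun T ↦ by simp only [map_zero, ite_self, zero_ne_one, if_false]
  rcases eq_or_ne I 1 with rfl | h1
  · refine .of_forall fun T ↦ ?_
    beta_reduce
    rw [if_pos rfl, if_pos fun P _ hd ↦ P.prime.not_isUnit (isUnit_of_dvd_one hd), map_one]
  · obtain ⟨M, hM, hIM⟩ := Ideal.exists_le_maximal I (by simpa using h1)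
    have hM0 : M ≠ ⊥ := by rintro rfl; exact h0 (by simpa using hIM)
    filter_upwards [eventually_ge_atTop {(⟨M, hM.isPrime, hM0⟩ : HeightOneSpectrum R)}] with T hT
    rw [if_neg h1, if_neg]
    intro hall
    exact hall _ (hT (Finset.mem_singleton_self _)) (Ideal.dvd_iff_le.mpr hIM)

end EulerProduct

section PrimeSums

open IsDedekindDomain

variable {K : Type} [Field K] [NumberField K]

theorem two_le_absNorm (P : HeightOneSpectrum (𝓞 K)) : 2 ≤ Ideal.absNorm P.asIdeal := by
  have h0 : Ideal.absNorm P.asIdeal ≠ 0 := by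
    simpa [Ideal.absNorm_eq_zero_iff] using P.ne_bot
  have h1 : Ideal.absNorm P.asIdeal ≠ 1 := by
    simpa [Ideal.absNorm_eq_one_iff] using P.isPrime.ne_top
  omega

theorem norm_natCast_cpow_neg_lt_one {N : ℕ} (hN : 2 ≤ N) {s : ℂ} (hs : 0 < s.re) :
    ‖(N : ℂ) ^ (-s)‖ < 1 := by
  rw [Complex.norm_natCast_cpow_of_pos (by omega), Complex.neg_re]
  exact Real.rpow_lt_one_of_one_lt_of_neg (by exact_mod_cast hN) (by linarith)

theorem one_sub_natCast_cpow_neg_ne_zero {N : ℕ} (hN : 2 ≤ N) {s : ℂ} (hs : 0 < s.re) :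
    1 - (N : ℂ) ^ (-s) ≠ 0 := by
  intro h
  have := norm_natCast_cpow_neg_lt_one hN hs
  rw [← sub_eq_zero.mp h, norm_one] at this
  exact lt_irrefl _ this

theorem hasDerivAt_one_sub_natCast_cpow_neg {N : ℕ} (hN : N ≠ 0) (s : ℂ) :
    HasDerivAt (fun z : ℂ ↦ 1 - (N : ℂ) ^ (-z)) (Real.log N * (N : ℂ) ^ (-s)) s := by
  have h := ((hasDerivAt_neg s).const_cpow (c := (N : ℂ))
    (Or.inl (by exact_mod_cast hN))).const_sub 1
  convert! h using 1
  rw [Complex.natCast_log]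
  ring

theorem logDeriv_one_sub_natCast_cpow_neg {N : ℕ} (hN : N ≠ 0) (s : ℂ) :
    logDeriv (fun z : ℂ ↦ 1 - (N : ℂ) ^ (-z)) s =
      Real.log N * ((N : ℂ) ^ (-s) / (1 - (N : ℂ) ^ (-s))) := by
  rw [logDeriv_apply, (hasDerivAt_one_sub_natCast_cpow_neg hN s).deriv, mul_div_assoc]

theorem norm_absNorm_cpow_neg (P : HeightOneSpectrum (𝓞 K)) (s : ℂ) :
    ‖(Ideal.absNorm P.asIdeal : ℂ) ^ (-s)‖ = (Ideal.absNorm P.asIdeal : ℝ) ^ (-s.re) := by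
  have := two_le_absNorm P
  rw [Complex.norm_natCast_cpow_of_pos (by omega), Complex.neg_re]

theorem summable_absNorm_prime_rpow_neg {r : ℝ} (hr : 1 < r) :
    Summable fun P : HeightOneSpectrum (𝓞 K) ↦ (Ideal.absNorm P.asIdeal : ℝ) ^ (-r) :=
  (summable_absNorm_rpow_neg K hr).comp_injective fun _ _ ↦ HeightOneSpectrum.ext

theorem summable_logDeriv_euler_factor {s : ℂ} (hs : 1 < s.re) :
    Summable fun P : HeightOneSpectrum (𝓞 K) ↦
      logDeriv (fun z : ℂ ↦ 1 - (Ideal.absNorm P.asIdeal : ℂ) ^ (-z)) s := by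
  obtain ⟨r, hr1, hrs⟩ := exists_between hs
  refine Summable.of_norm_bounded ((summable_absNorm_prime_rpow_neg (K := K) hr1).mul_left
    ((s.re - r)⁻¹ * 2)) fun P ↦ ?_
  have hN := two_le_absNorm P
  have hNP := norm_absNorm_cpow_neg P s
  set N := Ideal.absNorm P.asIdeal
  have hN' : (2 : ℝ) ≤ N := by exact_mod_cast hN
  have hN0 : (0 : ℝ) < N := by linarith
  have hle : (N : ℝ) ^ (-s.re) ≤ 2⁻¹ := by
    calc (N : ℝ) ^ (-s.re) ≤ (N : ℝ) ^ (-1 : ℝ) :=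
          Real.rpow_le_rpow_of_exponent_le (by linarith) (by linarith)
      _ ≤ 2⁻¹ := by rw [Real.rpow_neg_one]; gcongr
  have hden : 2⁻¹ ≤ ‖1 - (N : ℂ) ^ (-s)‖ := by
    have := norm_sub_norm_le (1 : ℂ) ((N : ℂ) ^ (-s))
    rw [norm_one, hNP] at this
    linarith
  have hlog : Real.log N ≤ (s.re - r)⁻¹ * (N : ℝ) ^ (s.re - r) := by
    rw [inv_mul_eq_div]
    exact Real.log_le_rpow_div hN0.le (by linarith)
  rw [logDeriv_one_sub_natCast_cpow_neg (by omega), norm_mul, norm_div, hNP, Complex.norm_real,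
    Real.norm_of_nonneg (Real.log_nonneg (by linarith))]
  calc Real.log N * ((N : ℝ) ^ (-s.re) / ‖1 - (N : ℂ) ^ (-s)‖)
      ≤ ((s.re - r)⁻¹ * (N : ℝ) ^ (s.re - r)) * ((N : ℝ) ^ (-s.re) / 2⁻¹) := by
        gcongr
    _ = (s.re - r)⁻¹ * 2 * ((N : ℝ) ^ (s.re - r) * (N : ℝ) ^ (-s.re)) := by
        rw [div_inv_eq_mul]; ring
    _ = _ := by rw [← Real.rpow_add hN0]; congr 2; ring

theorem multipliableLocallyUniformlyOn_euler_factor {r : ℝ} (hr : 1 < r) :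
    MultipliableLocallyUniformlyOn
      (fun (P : HeightOneSpectrum (𝓞 K)) (s : ℂ) ↦ 1 - (Ideal.absNorm P.asIdeal : ℂ) ^ (-s))
      {s : ℂ | r < s.re} := by
  simp only [sub_eq_add_neg (1 : ℂ)]
  refine Summable.multipliableLocallyUniformlyOn_one_add (isOpen_lt continuous_const Complex.continuous_re)
    (summable_absNorm_prime_rpow_neg (K := K) hr) (.of_forall fun P s hs ↦ ?_) fun P ↦ ?_
  · have := two_le_absNorm P
    rw [norm_neg, norm_absNorm_cpow_neg]
    exact Real.rpow_le_rpow_of_exponent_le (by exact_mod_cast (by omega))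
      (neg_le_neg (le_of_lt hs))
  · have := two_le_absNorm P
    have hne : (Ideal.absNorm P.asIdeal : ℂ) ≠ 0 := by exact_mod_cast (by omega)
    exact (continuous_neg.const_cpow (Or.inl hne)).neg.continuousOn

variable {Z : ℂ → ℂ}

theorem IsDedekindZeta.mul_tprod_eq_one (hZ : IsDedekindZeta K Z) {s : ℂ} (hs : 1 < s.re) :
    Z s * ∏' P : HeightOneSpectrum (𝓞 K), (1 - (Ideal.absNorm P.asIdeal : ℂ) ^ (-s)) = 1 := by
  have hs0 : s ≠ 0 := Complex.ne_zero_of_re_pos (by linarith)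
  set h : Ideal (𝓞 K) →*₀ ℂ := (riemannZetaSummandHom hs0).comp Ideal.absNorm
  have happ (I : Ideal (𝓞 K)) : h I = (Ideal.absNorm I : ℂ) ^ (-s) := rfl
  have hsum : Summable h := by
    refine Summable.of_norm_bounded (summable_absNorm_rpow_neg K hs) fun I ↦ ?_
    rw [happ, Complex.norm_natCast_cpow_of_re_ne_zero _ (by simp; linarith), Complex.neg_re]
  rw [hZ.2.2 s hs]
  refine Eq.trans (congrArg (· * _) ?_) (tsum_ideal_mul_tprod_one_sub h hsum)
  refine tsum_subtype_eq_of_support_subset (f := h) (s := {I | I ≠ 0}) fun I hI h0 ↦ ?_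
  exact hI (by rw [h0, map_zero])

theorem IsDedekindZeta.hasSum_neg_logDeriv (hZ : IsDedekindZeta K Z) {s : ℂ} (hs : 1 < s.re) :
    HasSum (fun P : HeightOneSpectrum (𝓞 K) ↦ (Real.log (Ideal.absNorm P.asIdeal) : ℂ) *
      ((Ideal.absNorm P.asIdeal : ℂ) ^ (-s) / (1 - (Ideal.absNorm P.asIdeal : ℂ) ^ (-s))))
      (-logDeriv Z s) := by
  obtain ⟨r, hr1, hrs⟩ := exists_between hs
  have hN0 (P : HeightOneSpectrum (𝓞 K)) : Ideal.absNorm P.asIdeal ≠ 0 := by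
    have := two_le_absNorm P
    omega
  have hdiff (P : HeightOneSpectrum (𝓞 K)) : DifferentiableOn ℂ
      (fun z : ℂ ↦ 1 - (Ideal.absNorm P.asIdeal : ℂ) ^ (-z)) {z : ℂ | r < z.re} := fun z _ ↦
    (hasDerivAt_one_sub_natCast_cpow_neg (hN0 P) z).differentiableAt.differentiableWithinAt
  have hopen (c : ℝ) : IsOpen {z : ℂ | c < z.re} := isOpen_lt continuous_const Complex.continuous_re
  have hZeq : Z =ᶠ[nhds s] fun z ↦
      (∏' P : HeightOneSpectrum (𝓞 K), (1 - (Ideal.absNorm P.asIdeal : ℂ) ^ (-z))) ^ (-1 : ℤ) := by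
    filter_upwards [(hopen 1).mem_nhds hs] with z hz
    rw [zpow_neg_one]
    exact eq_inv_of_mul_eq_one_left (hZ.mul_tprod_eq_one hz)
  have hlog := logDeriv_tprod_eq_tsum (hopen r) (x := s) hrs (f := fun (P : HeightOneSpectrum (𝓞 K)) z ↦
      1 - (Ideal.absNorm P.asIdeal : ℂ) ^ (-z))
    (fun P ↦ one_sub_natCast_cpow_neg_ne_zero (two_le_absNorm P) (by linarith))
    hdiff (summable_logDeriv_euler_factor hs) (multipliableLocallyUniformlyOn_euler_factor hr1)
    (right_ne_zero_of_mul (by rw [hZ.mul_tprod_eq_one hs]; exact one_ne_zero))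
  have hd := ((multipliableLocallyUniformlyOn_euler_factor (K := K)
    hr1).hasProdLocallyUniformlyOn.differentiableOn
    (.of_forall fun T ↦ .fun_finsetProd fun P _ ↦ hdiff P) (hopen r)).differentiableAt
    ((hopen r).mem_nhds hrs)
  have hneg : -logDeriv Z s = ∑' P : HeightOneSpectrum (𝓞 K),
      logDeriv (fun z : ℂ ↦ 1 - (Ideal.absNorm P.asIdeal : ℂ) ^ (-z)) s := by
    rw [← hlog, logDeriv_apply, hZeq.deriv_eq, hZeq.eq_of_nhds, ← logDeriv_apply,
      logDeriv_fun_zpow hd]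
    simp
  rw [hneg]
  simp only [← logDeriv_one_sub_natCast_cpow_neg (hN0 _)]
  exact (summable_logDeriv_euler_factor hs).hasSum

end PrimeSums

section Positivity

theorem hasSum_exp_mul_cos {N : ℕ} (hN : 2 ≤ N) {σ : ℝ} (hσ : 0 < σ) (t : ℝ) :
    HasSum (fun m : ℕ ↦ Real.exp (-(((m + 1 : ℕ) : ℝ) * σ * Real.log N)) *
      Real.cos (((m + 1 : ℕ) : ℝ) * Real.log N * t))
      ((N : ℂ) ^ (-((σ : ℂ) + t * I)) / (1 - (N : ℂ) ^ (-((σ : ℂ) + t * I)))).re := by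
  have hq := norm_natCast_cpow_neg_lt_one hN (s := (σ : ℂ) + t * I) (by simpa using hσ)
  have h := Complex.hasSum_re ((hasSum_geometric_of_norm_lt_one hq).mul_left
    ((N : ℂ) ^ (-((σ : ℂ) + t * I))))
  rw [← div_eq_mul_inv] at h
  convert h using 2 with m
  have hN0 : (N : ℂ) ≠ 0 := by exact_mod_cast (by omega)
  rw [← pow_succ', Complex.cpow_def_of_ne_zero hN0, ← Complex.exp_nat_mul, Complex.exp_re,
    ← Complex.natCast_log, ← Real.cos_neg]
  congr 2 <;> simp [-Complex.natCast_log] <;> ring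

theorem kappa_le_one : kappa ≤ 1 := by
  rw [kappa, div_le_one (by positivity)]
  exact Real.one_le_sqrt.mpr (by norm_num)

theorem le_sigma1 (σ : ℝ) : σ ≤ sigma1 σ := by
  have : 2 * σ ≤ Real.sqrt (1 + 4 * σ ^ 2) := Real.le_sqrt_of_sq_le (by nlinarith)
  rw [sigma1]
  linarith

theorem sum_euler_factor_nonneg {n : ℕ} {a : ℕ → ℝ}
    (hP : ∀ θ : ℝ, 0 ≤ ∑ k ∈ Finset.range (n + 1), a k * Real.cos (k * θ))
    {N : ℕ} (hN : 2 ≤ N) {σ σ' κ : ℝ} (hσ : 0 < σ) (hσ' : σ ≤ σ') (hκ : κ ≤ 1) (γ : ℝ) :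
    0 ≤ ∑ k ∈ Finset.range (n + 1), a k *
      (((N : ℂ) ^ (-((σ : ℂ) + (k * γ : ℝ) * I)) /
          (1 - (N : ℂ) ^ (-((σ : ℂ) + (k * γ : ℝ) * I)))).re -
        κ * ((N : ℂ) ^ (-((σ' : ℂ) + (k * γ : ℝ) * I)) /
          (1 - (N : ℂ) ^ (-((σ' : ℂ) + (k * γ : ℝ) * I)))).re) := by
  have h := hasSum_sum fun k (_ : k ∈ Finset.range (n + 1)) ↦
    ((hasSum_exp_mul_cos hN hσ (k * γ)).sub
      ((hasSum_exp_mul_cos hN (hσ.trans_le hσ') (k * γ)).mul_left κ)).mul_left (a k)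
  refine h.nonneg fun m ↦ ?_
  have hlog : 0 ≤ Real.log N := Real.log_natCast_nonneg N
  have hexp : 0 ≤ Real.exp (-(((m + 1 : ℕ) : ℝ) * σ * Real.log N)) -
      κ * Real.exp (-(((m + 1 : ℕ) : ℝ) * σ' * Real.log N)) := by
    have h1 : Real.exp (-(((m + 1 : ℕ) : ℝ) * σ' * Real.log N)) ≤
        Real.exp (-(((m + 1 : ℕ) : ℝ) * σ * Real.log N)) := by gcongr
    nlinarith [Real.exp_pos (-(((m + 1 : ℕ) : ℝ) * σ' * Real.log N))]
  refine (mul_nonneg hexp (hP (((m + 1 : ℕ) : ℝ) * Real.log N * γ))).trans_eq ?_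
  rw [Finset.mul_sum]
  refine Finset.sum_congr rfl fun k _ ↦ ?_
  rw [mul_left_comm (k : ℝ)]
  ring

end Positivity

open IsDedekindDomain in
theorem IsDedekindZeta.hasSum_fdiff {K : Type} [Field K] [NumberField K] {Z : ℂ → ℂ}
    (hZ : IsDedekindZeta K Z) {σ : ℝ} (hσ : 1 < σ) (t : ℝ) :
    HasSum (fun P : HeightOneSpectrum (𝓞 K) ↦ Real.log (Ideal.absNorm P.asIdeal) *
      (((Ideal.absNorm P.asIdeal : ℂ) ^ (-((σ : ℂ) + t * I)) /
          (1 - (Ideal.absNorm P.asIdeal : ℂ) ^ (-((σ : ℂ) + t * I)))).re -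
        kappa * ((Ideal.absNorm P.asIdeal : ℂ) ^ (-((sigma1 σ : ℂ) + t * I)) /
          (1 - (Ideal.absNorm P.asIdeal : ℂ) ^ (-((sigma1 σ : ℂ) + t * I)))).re))
      (fdiff Z σ t) := by
  have h0 := Complex.hasSum_re (hZ.hasSum_neg_logDeriv (s := (σ : ℂ) + t * I) (by simpa using hσ))
  have h1 := Complex.hasSum_re (hZ.hasSum_neg_logDeriv (s := (sigma1 σ : ℂ) + t * I)
    (by simpa using hσ.trans_le (le_sigma1 σ)))
  convert! h0.sub (h1.mul_left kappa) using 1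
  · funext P
    rw [Complex.re_ofReal_mul, Complex.re_ofReal_mul]
    ring
  · rw [fdiff, Complex.sub_re, Complex.re_ofReal_mul, Complex.neg_re, Complex.neg_re]
    ring

/-- If `P(θ) = Σ_{k=0}^{n} a_k cos(kθ)` is a nonnegative trigonometric polynomial with
nonnegative coefficients, then `Σ_{k=0}^{n} a_k f(σ, k γ0) ≥ 0` for every `σ > 1` and
real `γ0`. -/
theorem sum_fdiff_nonneg (K : Type) [Field K] [NumberField K] (Z : ℂ → ℂ)
    (hZ : IsDedekindZeta K Z) (n : ℕ) (a : ℕ → ℝ) (ha : ∀ k ≤ n, 0 ≤ a k)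
    (hP : ∀ θ : ℝ, 0 ≤ ∑ k ∈ Finset.range (n + 1), a k * Real.cos (k * θ))
    (σ : ℝ) (hσ : 1 < σ) (γ0 : ℝ) :
    0 ≤ ∑ k ∈ Finset.range (n + 1), a k * fdiff Z σ (k * γ0) := by
  refine (hasSum_sum fun k (_ : k ∈ Finset.range (n + 1)) ↦
    (hZ.hasSum_fdiff hσ (k * γ0)).mul_left (a k)).nonneg fun P ↦ ?_
  simp only [mul_left_comm (a _), ← Finset.mul_sum]
  exact mul_nonneg (Real.log_natCast_nonneg _) (sum_euler_factor_nonneg hP (two_le_absNorm P)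
    (zero_lt_one.trans hσ) (le_sigma1 σ) kappa_le_one γ0)
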